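/- Let R > 0 and let Ω be a compact subset of the open ball B_R of radius R centered at the origin in ℝ³. Let ρ₁, ρ₂, f₁, f₂, g₁, g₂ : ℝ³ → ℝ be bounded measurable functions with ρ₁ − 1, ρ₂ − 1, f₁, f₂, g₁, g₂ all vanishing outside Ω. Assume: (a) ∫(ρ₁f₁ − ρ₂f₂)h = 0 and (b) ∫(ρ₁g₁ − ρ₂g₂)h = 0 for every harmonic function h : ℝ³ → ℝ; (c) for every x ∈ ℝ³ with |x| = R, (∫ρ₁g₁ dz)·∫(ρ₁(y)−1)/(4π|x−y|) dy + ∫ρ₁f₁ dy − (1/6)∫ρ₁(y)g₁(y)|x−y|² dy = (∫ρ₂g₂ dz)·∫(ρ₂(y)−1)/(4π|x−y|) dy + ∫ρ₂f₂ dy − (1/6)∫ρ₂(y)g₂(y)|x−y|² dy; and (d) either ρ₁g₁ ≤ ρ₂g₂ almost everywhere or ρ₂g₂ ≤ ρ₁g₁ almost everywhere. Then ρ₁g₁ = ρ₂g₂ almost everywhere; and if in addition ∫_{ℝ³} ρ₁g₁ ≠ 0, then ∫_{ℝ³}(ρ₁ − ρ₂)(x) h(x) dx = 0 for every harmonic function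 h : ℝ³ → ℝ. -/

import Mathlib

noncomputable section
open MeasureTheory

/-- ℝ³ with the Euclidean norm. -/
abbrev R3 := EuclideanSpace ℝ (Fin 3)

/-- The Laplacian `Δf = ∑ᵢ ∂²f/∂xᵢ²` on ℝ³. -/
def lap {E : Type*} [NormedAddCommGroup E] [NormedSpace ℝ E] (f : R3 → E) (x : R3) : E :=
  ∑ i : Fin 3, iteratedFDeriv ℝ 2 f x ![EuclideanSpace.single i 1, EuclideanSpace.single i 1]

/-- A real-valued function on ℝ³ is harmonic if it is C² and its Laplacian vanishes. -/
def Harmonic (h : R3 → ℝ) : Prop := ContDiff ℝ 2 h ∧ ∀ x, lap h x = 0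

/-- scalar remainder estimate -/
lemma aux_rsqrt (s : ℝ) (hs : |s| ≤ 1/2) :
    |(√(1+s))⁻¹ - (1 + (-1/2) * s + 3/8*s^2)| ≤ 4 * |s|^3 := by
  obtain ⟨h1, h2⟩ := abs_le.mp hs
  have hpos : 0 < √(1+s) := Real.sqrt_pos.mpr (by linarith)
  have hsq : √(1+s)^2 = 1+s := Real.sq_sqrt (by linarith)
  obtain ⟨P, hP⟩ : ∃ P, P = 1 + (-1/2) * s + 3/8*s^2 := ⟨_, rfl⟩
  rw [← hP]
  have hPpos : 1/2 ≤ P := by nlinarith [sq_nonneg s]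
  obtain ⟨w, hw⟩ : ∃ w, w = (√(1+s))⁻¹ := ⟨_, rfl⟩
  rw [← hw]
  have hwpos : 0 < w := hw ▸ inv_pos.mpr hpos
  have hw2 : w^2 * (1+s) = 1 := by
    rw [hw, inv_pow, hsq]; exact inv_mul_cancel₀ (by linarith)
  have e1 : 1 - (1+s)*P^2 = -s^3*(5/8 - 15/64*s + 9/64*s^2) := by rw [hP]; ring
  have e2 : (w - P)*(w+P) = w^2 * (-s^3*(5/8 - 15/64*s + 9/64*s^2)) := by
    rw [← e1]
    linear_combination (P^2) * hw2
  have hw2' : w^2 ≤ 2 := by nlinarith [sq_nonneg w]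
  have h3 : |w - P| * (w+P) = w^2 * (|s|^3 * (5/8 - 15/64*s + 9/64*s^2)) := by
    have := congrArg abs e2
    rw [abs_mul, abs_mul, abs_mul, abs_neg, abs_of_pos (by linarith : 0 < w+P),
      abs_of_nonneg (sq_nonneg w), abs_pow s, abs_of_pos (by nlinarith [sq_nonneg s] : 0 < 5/8 - 15/64*s + 9/64*s^2)] at this
    exact this
  have h4 : 5/8 - 15/64*s + 9/64*s^2 ≤ 1 := by nlinarith
  have h5 : 0 ≤ |s|^3 := by positivity
  have h6 : w^2 * (|s|^3 * (5/8 - 15/64*s + 9/64*s^2)) ≤ 2 * (|s|^3*1) := by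
    apply mul_le_mul hw2' _ _ (by norm_num)
    · exact mul_le_mul_of_nonneg_left h4 h5
    · exact mul_nonneg h5 (by nlinarith [sq_nonneg s])
  nlinarith [abs_nonneg (w-P)]

lemma aux_rinv (s : ℝ) (hs : |s| ≤ 1/2) :
    |(1+s)⁻¹ - (1 + (-1) * s + 1 * s^2)| ≤ 4 * |s|^3 := by
  obtain ⟨h1, h2⟩ := abs_le.mp hs
  have h0 : 0 < 1 + s := by linarith
  have e : (1+s)⁻¹ - (1 + (-1) * s + 1 * s^2) = -s^3 * (1+s)⁻¹ := by field_simp; ring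
  rw [e, abs_mul, abs_neg, abs_pow, abs_of_pos (inv_pos.mpr h0), mul_comm]
  gcongr
  rw [inv_le_comm₀ h0 (by norm_num)]
  linarith

/-- six point sum -/
noncomputable def six (F : R3 → ℝ) (x : R3) (t : ℝ) : ℝ :=
  ∑ i : Fin 3, (F (x + t • EuclideanSpace.single i 1) + F (x + (-t) • EuclideanSpace.single i 1) - 2 * F x)

lemma nsq (x : R3) (t : ℝ) (i : Fin 3) :
    ‖x + t • EuclideanSpace.single i (1:ℝ)‖^2 = ‖x‖^2 + (2 * t * x i + t^2) := by
  rw [norm_add_sq_real, inner_smul_right, EuclideanSpace.inner_single_right]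
  simp [norm_smul]
  ring

lemma nsq3 (x : R3) : ‖x‖^2 = x 0 ^2 + x 1 ^2 + x 2^2 := by
  rw [EuclideanSpace.norm_sq_eq]; simp [Fin.sum_univ_three]

lemma abs_coord (x : R3) (i : Fin 3) : |x i| ≤ ‖x‖ := by
  simpa using PiLp.norm_apply_le x i

lemma six_gen (G : ℝ → ℝ) (α β : ℝ) (hβ : |β| ≤ 1)
    (hG : ∀ s, |s| ≤ 1/2 → |G s - (1 + α * s + β * s^2)| ≤ 4 * |s|^3)
    (z : R3) (t : ℝ) (ht : 0 < t) (htz : 8 * t ≤ ‖z‖) :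
    |six (fun x => G (‖x‖^2/‖z‖^2 - 1)) z t - (6*α+8*β) * (t/‖z‖)^2| ≤ 1000 * (t/‖z‖)^3 := by
  have ha : 0 < ‖z‖ := by linarith
  have hG0 : G 0 = 1 := by
    have := hG 0 (by norm_num)
    norm_num at this
    linarith
  obtain ⟨τ, hτ⟩ : ∃ τ, τ = t/‖z‖ := ⟨_, rfl⟩
  have hτ0 : 0 < τ := hτ ▸ div_pos ht ha
  have hτ1 : τ ≤ 1/8 := by rw [hτ, div_le_iff₀ ha]; linarith
  obtain ⟨c, hc⟩ : ∃ c : Fin 3 → ℝ, ∀ i, c i = z i / ‖z‖ := ⟨_, fun _ => rfl⟩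
  have hc1 : ∀ i, |c i| ≤ 1 := by
    intro i; rw [hc, abs_div, abs_norm, div_le_one ha]; exact abs_coord z i
  have hcs : c 0^2 + c 1^2+c 2^2 = 1 := by
    simp only [hc, div_pow]
    rw [← add_div, ← add_div, ← nsq3, div_self (by positivity)]
  have key : ∀ i, ∀ σ : ℝ, ‖z + (σ * t) • EuclideanSpace.single i (1:ℝ)‖^2/‖z‖^2 - 1
      = 2 * (σ*τ) * c i + (σ*τ)^2 := by
    intro i σ
    rw [nsq, hc, hτ]; field_simp; ring
  have kp : ∀ i, ‖z + t • EuclideanSpace.single i (1:ℝ)‖^2/‖z‖^2 - 1 = 2 * τ * c i + τ^2 := by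
    intro i; simpa using key i 1
  have km : ∀ i, ‖z + (-t) • EuclideanSpace.single i (1:ℝ)‖^2/‖z‖^2 - 1 = -2 * τ * c i + τ^2 := by
    intro i; have := key i (-1); simp only [neg_mul, one_mul] at this; rw [this]; ring
  have bd : ∀ s, |s| ≤ 3*τ → |G s - (1 + α * s + β * s^2)| ≤ 108 * τ^3 := by
    intro s hs
    refine (hG s (by linarith)).trans ?_
    have : |s|^3 ≤ (3*τ)^3 := by gcongr
    nlinarith
  have bp : ∀ i, |2 * τ * c i + τ^2| ≤ 3*τ := by
    intro i
    obtain ⟨h1, h2⟩ := abs_le.mp (hc1 i)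
    rw [abs_le]; constructor <;> nlinarith
  have bm : ∀ i, |-2 * τ * c i + τ^2| ≤ 3*τ := by
    intro i
    obtain ⟨h1, h2⟩ := abs_le.mp (hc1 i)
    rw [abs_le]; constructor <;> nlinarith
  have Bp := fun i => abs_le.mp (bd _ (bp i))
  have Bm := fun i => abs_le.mp (bd _ (bm i))
  unfold six
  simp only [kp, km, Fin.sum_univ_three, div_self (by positivity : ‖z‖^2 ≠ 0), sub_self, hG0]
  rw [← hτ]
  have hβτ : |β * τ^4| ≤ τ^3 := by
    rw [abs_mul, abs_of_pos (by positivity : 0 < τ^4)]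
    calc |β| * τ^4 ≤ 1 * τ^4 := by gcongr
      _ = τ * τ^3 := by ring
      _ ≤ 1 * τ^3 := by gcongr; linarith
      _ = τ^3 := one_mul _
  obtain ⟨b1, b2⟩ := abs_le.mp hβτ
  have id : (1 + α * (2 * τ * c 0 + τ^2) + β * (2 * τ * c 0 + τ^2)^2)
     + (1 + α * (-2 * τ * c 0 + τ^2) + β * (-2 * τ * c 0 + τ^2)^2)
     + (1 + α * (2 * τ * c 1 + τ^2) + β * (2 * τ * c 1 + τ^2)^2)
     + (1 + α * (-2 * τ * c 1 + τ^2) + β * (-2 * τ * c 1 + τ^2)^2)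
     + (1 + α * (2 * τ * c 2 + τ^2) + β * (2 * τ * c 2 + τ^2)^2)
     + (1 + α * (-2 * τ * c 2 + τ^2) + β * (-2 * τ * c 2 + τ^2)^2)
     = 6 + (6*α+8*β)*τ^2 + 6 * (β * τ^4) := by
    linear_combination (8*β*τ^2) * hcs
  have hτ3 : 0 < τ^3 := by positivity
  have P0 := Bp 0
  have P1 := Bp 1
  have P2 := Bp 2
  have M0 := Bm 0
  have M1 := Bm 1
  have M2 := Bm 2
  rw [abs_le]
  constructor
  · linarith [P0.1, P1.1, P2.1, M0.1, M1.1, M2.1]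
  · linarith [P0.2, P1.2, P2.2, M0.2, M1.2, M2.2]

lemma six_newton (z : R3) (t : ℝ) (ht : 0 < t) (htz : 8 * t ≤ ‖z‖) :
    |six (fun x => ‖x‖⁻¹) z t| ≤ 1000 * (t^3 / ‖z‖^4) := by
  have ha : 0 < ‖z‖ := by linarith
  have := six_gen (fun s => (√(1+s))⁻¹) (-1/2) (3/8) (by rw [abs_le]; norm_num) aux_rsqrt z t ht htz
  have e : (fun x : R3 => ‖x‖⁻¹) = fun x => ‖z‖⁻¹ * (√(1+(‖x‖^2/‖z‖^2 - 1)))⁻¹ := by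
    funext x
    rw [add_sub_cancel, ← div_pow, Real.sqrt_sq (by positivity), inv_div]
    field_simp
  have e2 : six (fun x => ‖x‖⁻¹) z t = ‖z‖⁻¹ * six (fun x => (√(1+(‖x‖^2/‖z‖^2 - 1)))⁻¹) z t := by
    rw [e]; unfold six; rw [Finset.mul_sum]; congr 1; funext i; ring
  norm_num at this
  rw [e2, abs_mul, abs_of_pos (inv_pos.mpr ha)]
  norm_num
  calc _ ≤ ‖z‖⁻¹ * (1000 * (t/‖z‖)^3) := by gcongr
    _ = _ := by field_simp

lemma six_sq (z : R3) (t : ℝ) (ht : 0 < t) (htz : 8 * t ≤ ‖z‖) :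
    2 * (t^2/‖z‖^4) - 1000 * (t^3 / ‖z‖^5) ≤ six (fun x => (‖x‖^2)⁻¹) z t := by
  have ha : 0 < ‖z‖ := by linarith
  have := (abs_le.mp (six_gen (fun s => (1+s)⁻¹) (-1) 1 (by norm_num) aux_rinv z t ht htz)).1
  have e : (fun x : R3 => (‖x‖^2)⁻¹) = fun x => (‖z‖^2)⁻¹ * (1+(‖x‖^2/‖z‖^2 - 1))⁻¹ := by
    funext x
    rw [add_sub_cancel, inv_div]
    field_simp
  have e2 : six (fun x => (‖x‖^2)⁻¹) z t = (‖z‖^2)⁻¹ * six (fun x => (1+(‖x‖^2/‖z‖^2 - 1))⁻¹) z t := by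
    rw [e]; unfold six; rw [Finset.mul_sum]; congr 1; funext i; ring
  rw [e2]
  have h2 : 2 * (t/‖z‖)^2 - 1000 * (t/‖z‖)^3 ≤ six (fun x => (1+(‖x‖^2/‖z‖^2 - 1))⁻¹) z t := by
    linarith
  calc _ = (‖z‖^2)⁻¹ * (2 * (t/‖z‖)^2 - 1000 * (t/‖z‖)^3) := by field_simp
    _ ≤ _ := by gcongr

section ext
open Filter Topology

lemma dist_ge {R r : ℝ} {x y : R3} (hx : R ≤ ‖x‖) (hy : ‖y‖ ≤ r) : R - r ≤ ‖x - y‖ := by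
  linarith [norm_sub_norm_le x y]

lemma pot_bound {R r : ℝ} (hrR : r < R) {m : R3 → ℝ} 
    (hms : ∀ y, r < ‖y‖ → m y = 0) (x : R3) (hx : R ≤ ‖x‖) (y : R3) :
    ‖m y * ‖x - y‖⁻¹‖ ≤ |m y| * (R - r)⁻¹ := by
  rw [norm_mul, norm_inv, norm_norm, Real.norm_eq_abs]
  by_cases hy : ‖y‖ ≤ r
  · exact mul_le_mul_of_nonneg_left (inv_anti₀ (by linarith) (dist_ge hx hy)) (abs_nonneg _)
  · simp [hms y (not_le.mp hy)]

lemma pot_int {R r : ℝ} (hrR : r < R) {m : R3 → ℝ} (hm : Integrable m)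
    (hms : ∀ y, r < ‖y‖ → m y = 0) (x : R3) (hx : R ≤ ‖x‖) :
    Integrable (fun y => m y * ‖x - y‖⁻¹) := by
  refine (hm.abs.mul_const ((R - r)⁻¹)).mono' ?_ ?_
  · exact hm.aestronglyMeasurable.mul (Measurable.aestronglyMeasurable (by fun_prop))
  · exact Eventually.of_forall (pot_bound hrR hms x hx)

lemma pot_le {r : ℝ} {m : R3 → ℝ} (hm : Integrable m)
    (hms : ∀ y, r < ‖y‖ → m y = 0) (x : R3) (hx : r < ‖x‖) :
    |∫ y, m y * ‖x - y‖⁻¹| ≤ (∫ y, |m y|) * (‖x‖ - r)⁻¹ := by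
  rw [← integral_mul_const, ← Real.norm_eq_abs]
  exact norm_integral_le_of_norm_le (hm.abs.mul_const _)
    (Eventually.of_forall (pot_bound hx hms x le_rfl))

lemma pot_cont {R r : ℝ} (hrR : r < R) {m : R3 → ℝ} (hm : Integrable m)
    (hms : ∀ y, r < ‖y‖ → m y = 0) :
    ContinuousOn (fun x => ∫ y, m y * ‖x - y‖⁻¹) {x : R3 | R ≤ ‖x‖} := by
  refine continuousOn_of_dominated (bound := fun y => |m y| * (R - r)⁻¹) ?_ ?_ ?_ ?_
  · intro x hx; exact (pot_int hrR hm hms x hx).aestronglyMeasurable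
  · intro x hx; exact Eventually.of_forall (pot_bound hrR hms x hx)
  · exact hm.abs.mul_const _
  · refine Eventually.of_forall fun y => ?_
    by_cases hy : ‖y‖ ≤ r
    · refine continuousOn_const.mul (ContinuousOn.inv₀ (by fun_prop) ?_)
      intro x hx
      have := dist_ge hx hy
      intro h
      linarith
    · simp only [hms y (not_le.mp hy), zero_mul]
      exact continuousOn_const

lemma ext_nonpos {R r : ℝ} (hr : 0 ≤ r) (hrR : r < R) {m : R3 → ℝ} (hm : Integrable m)
    (hms : ∀ y, r < ‖y‖ → m y = 0)
    (h0 : ∀ x : R3, ‖x‖ = R → ∫ y, m y * ‖x - y‖⁻¹ = 0) (x : R3) (hx : R ≤ ‖x‖) :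
    ∫ y, m y * ‖x - y‖⁻¹ ≤ 0 := by
  by_contra! hpos
  obtain ⟨u, hu⟩ : ∃ u : R3 → ℝ, ∀ x, u x = ∫ y, m y * ‖x - y‖⁻¹ := ⟨_, fun _ => rfl⟩
  have huc : ContinuousOn u {x : R3 | R ≤ ‖x‖} := (pot_cont hrR hm hms).congr fun x _ => hu x
  rw [← hu] at hpos
  obtain ⟨M, hM⟩ : ∃ M, M = ∫ y, |m y| := ⟨_, rfl⟩
  have hM0 : 0 ≤ M := hM ▸ integral_nonneg fun _ => abs_nonneg _
  have hR : 0 < R := by linarith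
  obtain ⟨e, he⟩ : ∃ e, e = u x * R^2 / 2 := ⟨_, rfl⟩
  have he0 : 0 < e := by rw [he]; positivity
  have heR : e * (R^2)⁻¹ = u x / 2 := by rw [he]; field_simp
  obtain ⟨w, hw⟩ : ∃ w : R3 → ℝ, ∀ x, w x = u x + e * (‖x‖^2)⁻¹ := ⟨_, fun _ => rfl⟩
  have hwx : u x ≤ w x := by rw [hw]; have : 0 ≤ e * (‖x‖^2)⁻¹ := by positivity
                             linarith
  have hwc : ContinuousOn w {x : R3 | R ≤ ‖x‖} := by
    refine ContinuousOn.congr ?_ (fun x _ => hw x)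
    refine huc.add (continuousOn_const.mul (ContinuousOn.inv₀ (by fun_prop) ?_))
    intro x hx
    have : 0 < ‖x‖ := lt_of_lt_of_le hR hx
    positivity
  -- decay
  have hdecay : Tendsto (fun s : ℝ => M * (s - r)⁻¹ + e * (s^2)⁻¹) atTop (𝓝 0) := by
    have h1 : Tendsto (fun s : ℝ => (s - r)⁻¹) atTop (𝓝 0) :=
      tendsto_inv_atTop_zero.comp (tendsto_atTop_add_const_right _ (-r) tendsto_id)
    have h2 : Tendsto (fun s : ℝ => (s^2)⁻¹) atTop (𝓝 0) :=
      tendsto_inv_atTop_zero.comp (tendsto_pow_atTop (by norm_num))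
    simpa using (h1.const_mul M).add (h2.const_mul e)
  obtain ⟨B, hB⟩ := Filter.eventually_atTop.mp (hdecay.eventually_lt_const hpos)
  have hfar : ∀ z : R3, R ≤ ‖z‖ → B ≤ ‖z‖ → w z < u x := by
    intro z hz hzB
    refine lt_of_le_of_lt ?_ (hB _ hzB)
    rw [hw]
    have := (abs_le.mp (pot_le hm hms z (by linarith))).2
    rw [← hu, ← hM] at this
    linarith
  have hcpt : IsCompact ({x : R3 | R ≤ ‖x‖} ∩ Metric.closedBall 0 (max B ‖x‖)) :=
    (isCompact_closedBall _ _).inter_left (isClosed_le continuous_const continuous_norm)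
  obtain ⟨a, ⟨haR, haB⟩, hamax⟩ := hcpt.exists_isMaxOn ⟨x, hx, by simp⟩ (hwc.mono Set.inter_subset_left)
  have haR' : R ≤ ‖a‖ := haR
  have hxa : w x ≤ w a := hamax ⟨hx, by simp⟩
  have hglob : ∀ z : R3, R ≤ ‖z‖ → w z ≤ w a := by
    intro z hz
    by_cases hzB : B ≤ ‖z‖
    · linarith [hfar z hz hzB]
    · exact hamax ⟨hz, by simp; left; linarith⟩
  have haR2 : R < ‖a‖ := by
    refine lt_of_le_of_ne haR' fun h => ?_
    have : w a = u x / 2 := by rw [hw, ← h, heR, hu, h0 a h.symm, zero_add]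
    linarith
  have ha0 : 0 < ‖a‖ := by linarith
  obtain ⟨δ, hδ⟩ : ∃ δ, δ = R - r := ⟨_, rfl⟩
  have hδ0 : 0 < δ := by linarith
  obtain ⟨D, hD⟩ : ∃ D, D = 1000 * e / ‖a‖^5 + 1000 * M / δ^4 := ⟨_, rfl⟩
  have hD0 : 0 ≤ D := by rw [hD]; positivity
  obtain ⟨A, hA⟩ : ∃ A, A = 2 * e / ‖a‖^4 := ⟨_, rfl⟩
  have hA0 : 0 < A := by rw [hA]; positivity
  obtain ⟨t, ht0, ht1, ht2, ht3⟩ : ∃ t, 0 < t ∧ 8 * t ≤ δ ∧ t ≤ ‖a‖ - R ∧ t * (D + 1) ≤ A := by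
    refine ⟨min (min (δ/8) (‖a‖ - R)) (A/(D+1)), ?_, ?_, ?_, ?_⟩
    · refine lt_min (lt_min (by positivity) (by linarith)) (by positivity)
    · have : min (min (δ/8) (‖a‖ - R)) (A/(D+1)) ≤ δ/8 := (min_le_left _ _).trans (min_le_left _ _)
      linarith
    · exact (min_le_left _ _).trans (min_le_right _ _)
    · rw [← le_div_iff₀ (by linarith)]; exact min_le_right _ _
  have hn : ∀ i : Fin 3, ∀ s : ℝ, |s| = t → R ≤ ‖a + s • EuclideanSpace.single i (1:ℝ)‖ := by
    intro i s hs
    have h1 : ‖s • EuclideanSpace.single i (1:ℝ)‖ = t := by rw [norm_smul]; simp [hs]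
    have h2 := norm_sub_le (a + s • EuclideanSpace.single i (1:ℝ)) (s • EuclideanSpace.single i (1:ℝ))
    rw [add_sub_cancel_right, h1] at h2
    linarith
  have hnp := fun i => hn i t (abs_of_pos ht0)
  have hnm := fun i => hn i (-t) (by rw [abs_neg, abs_of_pos ht0])
  have hsix1 : six w a t ≤ 0 := by
    unfold six
    apply Finset.sum_nonpos
    intro i _
    linarith [hglob _ (hnp i), hglob _ (hnm i)]
  have hsix2 : six w a t = six u a t + e * six (fun x => (‖x‖^2)⁻¹) a t := by
    unfold six
    rw [Finset.mul_sum, ← Finset.sum_add_distrib]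
    congr 1; funext i
    simp only [hw]; ring
  have hsix3 : six u a t = ∫ y, m y * six (fun x => ‖x‖⁻¹) (a - y) t := by
    have hI := fun z hz => pot_int hrR hm hms z hz
    have : ∀ y, m y * six (fun x => ‖x‖⁻¹) (a - y) t = ∑ i : Fin 3,
        (m y * ‖(a + t • EuclideanSpace.single i (1:ℝ)) - y‖⁻¹
          + m y * ‖(a + (-t) • EuclideanSpace.single i (1:ℝ)) - y‖⁻¹ - 2 * (m y * ‖a - y‖⁻¹)) := by
      intro y
      unfold six
      rw [Finset.mul_sum]
      congr 1; funext i
      rw [add_sub_right_comm a, add_sub_right_comm a]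
      ring
    simp only [this]
    rw [integral_finsetSum]
    · unfold six
      congr 1; funext i
      rw [integral_sub, integral_add, integral_const_mul]
      · simp only [hu]
      · exact hI _ (hnp i)
      · exact hI _ (hnm i)
      · exact (hI _ (hnp i)).add (hI _ (hnm i))
      · exact (hI _ haR').const_mul 2
    · intro i _
      exact ((hI _ (hnp i)).add (hI _ (hnm i))).sub ((hI _ haR').const_mul 2)
  have hsix4 : |six u a t| ≤ M * (1000 * (t^3/δ^4)) := by
    rw [hsix3, hM, ← integral_mul_const, ← Real.norm_eq_abs]
    refine norm_integral_le_of_norm_le (hm.abs.mul_const _) (Eventually.of_forall fun y => ?_)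
    rw [norm_mul, Real.norm_eq_abs, Real.norm_eq_abs]
    by_cases hy : ‖y‖ ≤ r
    · have hd := dist_ge haR' hy
      rw [← hδ] at hd
      gcongr
      refine (six_newton _ t ht0 (by linarith)).trans ?_
      gcongr
    · simp [hms y (not_le.mp hy)]
  have hsix5 := six_sq a t ht0 (by linarith)
  have h6 := mul_le_mul_of_nonneg_left hsix5 he0.le
  have h7 := (abs_le.mp hsix4).1
  have h8 : t^2 * A - t^3 * D ≤ 0 := by
    have : t^2 * A - t^3 * D = e * (2 * (t^2/‖a‖^4) - 1000 * (t^3 / ‖a‖^5)) - M * (1000 * (t^3/δ^4)) := by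
      rw [hA, hD]; ring
    rw [this]; linarith
  have h9 : 0 < t^2 * (A - t * D) := by
    apply mul_pos (by positivity)
    linarith
  linarith [h9, show t^2 * (A - t * D) = t^2 * A - t^3 * D by ring]

lemma ext_zero {R r : ℝ} (hr : 0 ≤ r) (hrR : r < R) {m : R3 → ℝ} (hm : Integrable m)
    (hms : ∀ y, r < ‖y‖ → m y = 0)
    (h0 : ∀ x : R3, ‖x‖ = R → ∫ y, m y * ‖x - y‖⁻¹ = 0) (x : R3) (hx : R ≤ ‖x‖) :
    ∫ y, m y * ‖x - y‖⁻¹ = 0 := by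
  refine le_antisymm (ext_nonpos hr hrR hm hms h0 x hx) ?_
  have := ext_nonpos (m := fun y => - m y) hr hrR hm.neg (fun y hy => by simp [hms y hy])
    (fun x hx => by simp only [neg_mul]; rw [integral_neg, h0 x hx, neg_zero]) x hx
  simp only [neg_mul] at this
  rw [integral_neg] at this
  linarith
end ext

section reg
open Filter Topology

/-- Regularised Newton kernel. -/
def pk (ε : ℝ) (x : R3) : ℝ := (√(‖x‖^2 + ε^2))⁻¹

lemma pk_pos {ε : ℝ} (hε : 0 < ε) (x : R3) : 0 < pk ε x := by unfold pk; positivity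

lemma pk_cont {ε : ℝ} (hε : 0 < ε) : Continuous (pk ε) := by
  unfold pk
  refine Continuous.inv₀ (by fun_prop) fun x => ?_
  positivity

lemma pk_sq {ε : ℝ} (hε : 0 < ε) (x : R3) : pk ε x^2 * (‖x‖^2+ε^2) = 1 := by
  unfold pk
  rw [inv_pow, Real.sq_sqrt (by positivity)]
  exact inv_mul_cancel₀ (by positivity)

lemma pk_le {ε : ℝ} {x : R3} (hx : x ≠ 0) : pk ε x ≤ ‖x‖⁻¹ := by
  unfold pk
  have : 0 < ‖x‖ := norm_pos_iff.mpr hx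
  apply inv_anti₀ this
  apply Real.le_sqrt_of_sq_le
  nlinarith [sq_nonneg ε]

lemma pk_le' {ε : ℝ} (hε : 0 < ε) (x : R3) : pk ε x ≤ ε⁻¹ := by
  unfold pk
  apply inv_anti₀ hε
  apply Real.le_sqrt_of_sq_le
  nlinarith [sq_nonneg ‖x‖]

lemma pk_line {ε : ℝ} (hε : 0 < ε) (i : Fin 3) (x : R3) :
    HasLineDerivAt ℝ (pk ε) (-(x i) * pk ε x^3) x (EuclideanSpace.single i 1) := by
  unfold HasLineDerivAt pk
  simp only [nsq]
  have h1 : HasDerivAt (fun t : ℝ => ‖x‖^2 + (2 * t * x i + t^2) + ε^2) (2 * x i) 0 := by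
    have a1 : HasDerivAt (fun t : ℝ => 2 * t * x i) (2 * x i) 0 := by
      simpa using ((hasDerivAt_id (0:ℝ)).const_mul 2).mul_const (x i)
    have a2 : HasDerivAt (fun t : ℝ => t^2) 0 0 := by simpa using hasDerivAt_pow 2 (0:ℝ)
    simpa using ((a1.add a2).const_add (‖x‖^2)).add_const (ε^2)
  have h2 := (h1.sqrt (by simp; positivity)).fun_inv (by simp; positivity)
  refine h2.congr_deriv ?_
  simp only [mul_zero, zero_mul, zero_pow two_ne_zero, add_zero]
  have : 0 < √(‖x‖^2+ε^2) := by positivity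
  field_simp

lemma pk_line2 {ε : ℝ} (hε : 0 < ε) (i : Fin 3) (x : R3) :
    HasLineDerivAt ℝ (fun x => -(x i) * pk ε x^3) (-(pk ε x^3) + 3 * (x i)^2 * pk ε x^5) x
      (EuclideanSpace.single i 1) := by
  have h := pk_line hε i x
  unfold HasLineDerivAt at h ⊢
  have h1 : HasDerivAt (fun t : ℝ => -((x + t • EuclideanSpace.single i (1:ℝ)) i)) (-1) 0 := by
    have e : (fun t : ℝ => -((x + t • EuclideanSpace.single i (1:ℝ)) i)) = fun t => -(x i + t) := by
      funext t; simp
    rw [e]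
    exact ((hasDerivAt_id (0:ℝ)).const_add (x i)).fun_neg
  have h2 := h1.fun_mul (h.fun_pow 3)
  refine h2.congr_deriv ?_
  simp only [zero_smul, add_zero]
  norm_num
  ring

lemma line_shift {f : R3 → ℝ} {f' : ℝ} {x y v : R3} (h : HasLineDerivAt ℝ f f' (x - y) v) :
    HasLineDerivAt ℝ (fun x => f (x - y)) f' x v := by
  unfold HasLineDerivAt at h ⊢
  simpa only [add_sub_right_comm] using h

lemma ibp {f f' g g' : R3 → ℝ} {v : R3} (hf : ∀ x, HasLineDerivAt ℝ f (f' x) x v)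
    (hg : ∀ x, HasLineDerivAt ℝ g (g' x) x v) (hfc : Continuous f) (hfc' : Continuous f')
    (hgc : Continuous g) (hgc' : Continuous g') (hs : HasCompactSupport f)
    (hs' : HasCompactSupport f') :
    ∫ x, f x * g' x = - ∫ x, f' x * g x := by
  exact integral_bilinear_hasLineDerivAt_right_eq_neg_left_of_integrable (μ := volume)
    (B := ContinuousLinearMap.mul ℝ ℝ) (v := v)
    ((hfc'.mul hgc).integrable_of_hasCompactSupport hs'.mul_right)
    ((hfc.mul hgc').integrable_of_hasCompactSupport hs.mul_right)
    ((hfc.mul hgc).integrable_of_hasCompactSupport hs.mul_right) (fun x _ => hf x) (fun x _ => hg x)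

lemma lap_eq (φ : R3 → ℝ) (hφ : ContDiff ℝ 2 φ) (x : R3) :
    lap φ x = ∑ i : Fin 3, fderiv ℝ (fun x => fderiv ℝ φ x (EuclideanSpace.single i 1)) x
      (EuclideanSpace.single i 1) := by
  unfold lap
  congr 1; funext i
  rw [iteratedFDeriv_two_apply]
  have hd : DifferentiableAt ℝ (fderiv ℝ φ) x :=
    ((hφ.fderiv_right (m := 1) (by norm_num)).differentiable (by norm_num)) x
  rw [fderiv_clm_apply hd (differentiableAt_const _)]
  simp

lemma lap_pk (φ : R3 → ℝ) (hφ : ContDiff ℝ 2 φ) (hs : HasCompactSupport φ) {ε : ℝ} (hε : 0 < ε)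
    (y : R3) :
    ∫ x, lap φ x * pk ε (x - y) = - ∫ x, φ x * (3 * ε^2 * pk ε (x - y)^5) := by
  have hpc : Continuous fun x => pk ε (x - y) := (pk_cont hε).comp (by fun_prop)
  have hd1 : ContDiff ℝ 1 (fderiv ℝ φ) := hφ.fderiv_right (m := 1) (by norm_num)
  have hdi : ∀ i : Fin 3, ContDiff ℝ 1 (fun x => fderiv ℝ φ x (EuclideanSpace.single i 1)) :=
    fun i => hd1.clm_apply contDiff_const
  have hsi : ∀ i : Fin 3, HasCompactSupport (fun x => fderiv ℝ φ x (EuclideanSpace.single i 1)) :=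
    fun i => hs.fderiv_apply ℝ _
  have hsii : ∀ i : Fin 3, HasCompactSupport (fun x => fderiv ℝ
      (fun x => fderiv ℝ φ x (EuclideanSpace.single i 1)) x (EuclideanSpace.single i 1)) :=
    fun i => (hsi i).fderiv_apply ℝ _
  have hcii : ∀ i : Fin 3, Continuous (fun x => fderiv ℝ
      (fun x => fderiv ℝ φ x (EuclideanSpace.single i 1)) x (EuclideanSpace.single i 1)) :=
    fun i => ((hdi i).continuous_fderiv (by norm_num)).clm_apply continuous_const
  have hNi : ∀ i : Fin 3, Continuous fun x : R3 => -((x - y) i) * pk ε (x - y)^3 := by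
    intro i; fun_prop
  have hNii : ∀ i : Fin 3, Continuous fun x : R3 =>
      (-(pk ε (x-y)^3) + 3 * ((x-y) i)^2 * pk ε (x-y)^5) := by
    intro i; fun_prop
  have step : ∀ i : Fin 3, ∫ x, fderiv ℝ (fun x => fderiv ℝ φ x (EuclideanSpace.single i 1)) x
      (EuclideanSpace.single i 1) * pk ε (x - y) =
      ∫ x, φ x * (-(pk ε (x-y)^3) + 3 * ((x-y) i)^2 * pk ε (x-y)^5) := by
    intro i
    have l1 : ∀ x, HasLineDerivAt ℝ φ (fderiv ℝ φ x (EuclideanSpace.single i 1)) x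
        (EuclideanSpace.single i 1) := fun x =>
      ((hφ.differentiable (by norm_num)) x).hasFDerivAt.hasLineDerivAt _
    have l2 : ∀ x, HasLineDerivAt ℝ (fun x => fderiv ℝ φ x (EuclideanSpace.single i 1))
        (fderiv ℝ (fun x => fderiv ℝ φ x (EuclideanSpace.single i 1)) x
          (EuclideanSpace.single i 1)) x (EuclideanSpace.single i 1) := fun x =>
      (((hdi i).differentiable (by norm_num)) x).hasFDerivAt.hasLineDerivAt _
    have i1 := ibp l1 (fun x => line_shift (pk_line2 hε i (x - y))) hφ.continuous (hdi i).continuous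
      (hNi i) (hNii i) hs (hsi i)
    have i2 := ibp l2 (fun x => line_shift (pk_line hε i (x - y))) (hdi i).continuous (hcii i)
      hpc (hNi i) (hsi i) (hsii i)
    linarith
  simp only [lap_eq φ hφ, Finset.sum_mul]
  rw [integral_finsetSum]
  · simp only [step]
    rw [← integral_finsetSum, ← integral_neg]
    · congr 1; funext x
      rw [Fin.sum_univ_three]
      have h1 := pk_sq hε (x - y)
      rw [nsq3] at h1
      linear_combination (3 * φ x * pk ε (x-y)^3) * h1
    · intro i _
      exact (hφ.continuous.mul (hNii i)).integrable_of_hasCompactSupport hs.mul_right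
  · intro i _
    exact ((hcii i).mul hpc).integrable_of_hasCompactSupport (hsii i).mul_right

lemma pk_scale {ε : ℝ} (hε : 0 < ε) (z : R3) : pk ε (ε • z) = ε⁻¹ * pk 1 z := by
  unfold pk
  rw [norm_smul, mul_pow, Real.norm_eq_abs, sq_abs, show ε^2*‖z‖^2+ε^2 = ε^2 * (‖z‖^2+1^2) by ring,
    Real.sqrt_mul (by positivity), Real.sqrt_sq hε.le, mul_inv]

lemma scale_int (φ : R3 → ℝ) {ε : ℝ} (hε : 0 < ε) (y : R3) :
    ∫ x, φ x * (3 * ε^2 * pk ε (x - y)^5) = ∫ z, φ (y + ε • z) * (3 * pk 1 z^5) := by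
  rw [← integral_add_left_eq_self _ y]
  simp only [add_sub_cancel_left]
  have := Measure.integral_comp_smul (volume : Measure R3)
    (fun x => φ (y + x) * (3 * ε^2 * pk ε x^5)) ε
  rw [finrank_euclideanSpace_fin, abs_of_pos (by positivity), smul_eq_mul] at this
  rw [eq_comm, inv_mul_eq_iff_eq_mul₀ (by positivity)] at this
  rw [this, ← integral_const_mul]
  congr 1; funext z
  rw [pk_scale hε]
  field_simp

lemma pk_integrable : Integrable (fun z : R3 => 3 * pk 1 z^5) := by
  have := (integrable_rpow_neg_one_add_norm_sq (E := R3) (μ := volume) (r := 5)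
    (by rw [finrank_euclideanSpace_fin]; norm_num)).const_mul 3
  refine this.congr (Eventually.of_forall fun z => ?_)
  simp only [pk]
  congr 1
  rw [neg_div, Real.rpow_neg (by positivity), inv_pow, Real.sqrt_eq_rpow, ← Real.rpow_natCast _ 5,
    ← Real.rpow_mul (by positivity), add_comm]
  norm_num

lemma pk_integral_pos : 0 < ∫ z : R3, 3 * pk 1 z^5 := by
  rw [integral_pos_iff_support_of_nonneg _ pk_integrable]
  · have : Function.support (fun z : R3 => 3 * pk 1 z^5) = Set.univ := by
      ext z
      have := pk_pos one_pos z
      simp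
      positivity
    rw [this]; simp
  · intro z
    have := pk_pos one_pos z
    simp only [Pi.zero_apply]
    positivity

lemma pk_tendsto (x : R3) (hx : x ≠ 0) : Tendsto (fun ε => pk ε x) (𝓝[>] 0) (𝓝 ‖x‖⁻¹) := by
  have h0 : 0 < ‖x‖ := norm_pos_iff.mpr hx
  have : ContinuousAt (fun ε => pk ε x) 0 := by
    unfold pk
    refine ContinuousAt.inv₀ (by fun_prop) ?_
    simp [hx]
  have h := this.tendsto.mono_left (nhdsWithin_le_nhds (s := Set.Ioi 0))
  simpa [pk] using h
end reg

section final
open Filter Topology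

lemma lap_cont (φ : R3 → ℝ) (hφ : ContDiff ℝ 2 φ) : Continuous (lap φ) := by
  have hd1 : ContDiff ℝ 1 (fderiv ℝ φ) := hφ.fderiv_right (m := 1) (by norm_num)
  have : lap φ = fun x => ∑ i : Fin 3, fderiv ℝ
      (fun x => fderiv ℝ φ x (EuclideanSpace.single i 1)) x (EuclideanSpace.single i 1) := by
    funext x; exact lap_eq φ hφ x
  rw [this]
  refine continuous_finsetSum _ fun i _ => ?_
  have hdi : ContDiff ℝ 1 (fun x => fderiv ℝ φ x (EuclideanSpace.single i 1)) :=
    hd1.clm_apply contDiff_const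
  exact (hdi.continuous_fderiv (by norm_num)).clm_apply continuous_const

lemma lap_congr {φ ψ : R3 → ℝ} {x : R3} (h : φ =ᶠ[𝓝 x] ψ) : lap φ x = lap ψ x := by
  unfold lap
  rw [(h.iteratedFDeriv ℝ 2).eq_of_nhds]

lemma lap_supp {φ : R3 → ℝ} (h : HasCompactSupport φ) : HasCompactSupport (lap φ) := by
  refine HasCompactSupport.intro (K := tsupport φ) h fun x hx => ?_
  have : φ =ᶠ[𝓝 x] fun _ => 0 := notMem_tsupport_iff_eventuallyEq.mp hx
  rw [lap_congr this]
  unfold lap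
  simp [iteratedFDeriv_const_of_ne]

lemma moments {R r : ℝ} (hr : 0 ≤ r) (hrR : r < R) {m : R3 → ℝ} (hm : Integrable m)
    (hms : ∀ y, r < ‖y‖ → m y = 0)
    (h0 : ∀ x : R3, ‖x‖ = R → ∫ y, m y * ‖x - y‖⁻¹ = 0) (h : R3 → ℝ) (hh : Harmonic h) :
    ∫ y, m y * h y = 0 := by
  have hu := ext_zero hr hrR hm hms h0
  have hR : 0 < R := by linarith
  let χ : ContDiffBump (0 : R3) := ⟨R, R + 1, hR, by linarith⟩
  obtain ⟨φ, hφd⟩ : ∃ φ : R3 → ℝ, φ = fun x => χ x * h x := ⟨_, rfl⟩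
  have hφ : ContDiff ℝ 2 φ := by rw [hφd]; exact χ.contDiff.mul hh.1
  have hφs : HasCompactSupport φ := by rw [hφd]; exact χ.hasCompactSupport.mul_right
  have hφ1 : ∀ x : R3, ‖x‖ < R → lap φ x = 0 := by
    intro x hx
    rw [← hh.2 x]
    apply lap_congr
    have : χ =ᶠ[𝓝 x] 1 := χ.eventuallyEq_one_of_mem_ball (by simpa [χ] using hx)
    filter_upwards [this] with y hy
    rw [hφd]; simp [hy]
  have hφ2 : ∀ y, m y * φ y = m y * h y := by
    intro y
    by_cases hy : ‖y‖ ≤ r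
    · have : χ y = 1 := χ.one_of_mem_closedBall (by simp [χ]; linarith)
      simp [hφd, this]
    · simp [hms y (not_le.mp hy)]
  simp only [← hφ2]
  have hLc := lap_cont φ hφ
  have hLi : Integrable (lap φ) := hLc.integrable_of_hasCompactSupport (lap_supp hφs)
  obtain ⟨C, hC⟩ := hφs.exists_bound_of_continuous hφ.continuous
  have hC0 : 0 ≤ C := (norm_nonneg _).trans (hC 0)
  have hkc : Continuous fun z : R3 => 3 * pk 1 z^5 := by
    have := pk_cont one_pos; fun_prop
  -- identity
  have ident : ∀ ε : ℝ, 0 < ε → ∫ y, m y * ∫ z, φ (y + ε • z) * (3 * pk 1 z^5) =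
      - ∫ x, lap φ x * ∫ y, m y * pk ε (x - y) := by
    intro ε hε
    have hpc := pk_cont hε
    have e1 : ∀ y, ∫ z, φ (y + ε • z) * (3 * pk 1 z^5) = - ∫ x, lap φ x * pk ε (x - y) := by
      intro y; rw [lap_pk φ hφ hφs hε, scale_int φ hε, neg_neg]
    simp only [e1, mul_neg]
    rw [integral_neg]
    congr 1
    simp only [← integral_const_mul]
    rw [integral_integral_swap]
    · congr 1; funext x; congr 1; funext y; ring
    · have hI := (hm.mul_prod hLi).norm.mul_const ε⁻¹
      refine hI.mono' ?_ ?_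
      · have e : (Function.uncurry fun y x => m y * (lap φ x * pk ε (x - y))) =
          fun p : R3 × R3 => (m p.1 * lap φ p.2) * pk ε (p.2 - p.1) := by
            funext p; simp only [Function.uncurry]; ring
        rw [e]
        refine (hm.mul_prod hLi).aestronglyMeasurable.mul (Continuous.aestronglyMeasurable ?_)
        fun_prop
      · refine Eventually.of_forall fun p => ?_
        simp only [Function.uncurry]
        rw [← mul_assoc, norm_mul, Real.norm_of_nonneg (pk_pos hε _).le]
        gcongr
        exact pk_le' hε _
  have limR : Tendsto (fun ε => - ∫ x, lap φ x * ∫ y, m y * pk ε (x - y)) (𝓝[>] 0) (𝓝 0) := by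
    have hb : ∀ ε : ℝ, 0 < ε → ∀ x : R3, R ≤ ‖x‖ → ∀ y, ‖m y * pk ε (x - y)‖ ≤ |m y| * (R-r)⁻¹ := by
      intro ε hε x hx y
      refine le_trans ?_ (pot_bound hrR hms x hx y)
      by_cases hy : ‖y‖ ≤ r
      · have hd := dist_ge hx hy
        rw [norm_mul, norm_mul, Real.norm_of_nonneg (pk_pos hε _).le, norm_inv, norm_norm]
        gcongr
        apply pk_le
        intro h
        rw [h, norm_zero] at hd
        linarith
      · simp [hms y (not_le.mp hy)]
    have key : Tendsto (fun ε => ∫ x, lap φ x * ∫ y, m y * pk ε (x - y)) (𝓝[>] 0)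
        (𝓝 (∫ _ : R3, (0:ℝ))) := by
      refine tendsto_integral_filter_of_dominated_convergence
        (fun x => |lap φ x| * ((∫ y, |m y|) * (R - r)⁻¹)) ?_ ?_ (hLi.abs.mul_const _) ?_
      · filter_upwards [self_mem_nhdsWithin] with ε hε
        have hpc := pk_cont hε
        refine hLc.aestronglyMeasurable.mul ?_
        have : AEStronglyMeasurable (fun p : R3 × R3 => m p.2 * pk ε (p.1 - p.2))
            ((volume : Measure R3).prod volume) := by
          refine hm.aestronglyMeasurable.comp_snd.mul (Continuous.aestronglyMeasurable ?_)
          fun_prop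
        exact this.integral_prod_right'
      · filter_upwards [self_mem_nhdsWithin] with ε hε
        refine Eventually.of_forall fun x => ?_
        rw [norm_mul, Real.norm_eq_abs]
        by_cases hx : ‖x‖ < R
        · simp [hφ1 x hx]
        · gcongr
          rw [← integral_mul_const]
          exact norm_integral_le_of_norm_le (hm.abs.mul_const _)
            (Eventually.of_forall (hb ε hε x (not_lt.mp hx)))
      · refine Eventually.of_forall fun x => ?_
        by_cases hx : ‖x‖ < R
        · simp [hφ1 x hx]
        · have hx := not_lt.mp hx
          have : Tendsto (fun ε => ∫ y, m y * pk ε (x - y)) (𝓝[>] 0)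
              (𝓝 (∫ y, m y * ‖x - y‖⁻¹)) := by
            refine tendsto_integral_filter_of_dominated_convergence
              (fun y => |m y| * (R - r)⁻¹) ?_ ?_ (hm.abs.mul_const _) ?_
            · filter_upwards [self_mem_nhdsWithin] with ε hε
              have hpc := pk_cont hε
              exact hm.aestronglyMeasurable.mul (Continuous.aestronglyMeasurable (by fun_prop))
            · filter_upwards [self_mem_nhdsWithin] with ε hε
              exact Eventually.of_forall (hb ε hε x hx)
            · refine Eventually.of_forall fun y => ?_
              by_cases hy : ‖y‖ ≤ r
              · refine (pk_tendsto (x - y) ?_).const_mul _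
                have hd := dist_ge hx hy
                intro h
                rw [h, norm_zero] at hd
                linarith
              · simp [hms y (not_le.mp hy)]
          rw [hu x hx] at this
          simpa using this.const_mul (lap φ x)
    simpa using key.neg
  have limL : Tendsto (fun ε : ℝ => ∫ y, m y * ∫ z, φ (y + ε • z) * (3 * pk 1 z^5)) (𝓝[>] 0)
      (𝓝 (∫ y, m y * (φ y * ∫ z, 3 * pk 1 z^5))) := by
    have hb : ∀ ε : ℝ, ∀ y z : R3, ‖φ (y + ε • z) * (3 * pk 1 z^5)‖ ≤ C * (3 * pk 1 z^5) := by
      intro ε y z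
      have := pk_pos one_pos z
      rw [norm_mul, Real.norm_of_nonneg (by positivity : 0 ≤ 3 * pk 1 z^5)]
      gcongr
      exact hC _
    have hφc := hφ.continuous
    refine tendsto_integral_filter_of_dominated_convergence
      (fun y => |m y| * ∫ z, C * (3 * pk 1 z^5)) ?_ ?_ (hm.abs.mul_const _) ?_
    · refine Eventually.of_forall fun ε => ?_
      refine hm.aestronglyMeasurable.mul ?_
      have : AEStronglyMeasurable (fun p : R3 × R3 => φ (p.1 + ε • p.2) * (3 * pk 1 p.2^5))
          ((volume : Measure R3).prod volume) := by
        refine Continuous.aestronglyMeasurable ?_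
        exact (hφc.comp (by fun_prop)).mul (hkc.comp continuous_snd)
      exact this.integral_prod_right'
    · refine Eventually.of_forall fun ε => Eventually.of_forall fun y => ?_
      rw [norm_mul, Real.norm_eq_abs]
      gcongr
      exact norm_integral_le_of_norm_le (pk_integrable.const_mul C)
        (Eventually.of_forall (hb ε y))
    · refine Eventually.of_forall fun y => ?_
      refine Tendsto.const_mul _ ?_
      rw [← integral_const_mul]
      refine tendsto_integral_filter_of_dominated_convergence
        (fun z => C * (3 * pk 1 z^5)) ?_ ?_ (pk_integrable.const_mul C) ?_
      · refine Eventually.of_forall fun ε => Continuous.aestronglyMeasurable ?_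
        exact (hφc.comp (by fun_prop)).mul hkc
      · exact Eventually.of_forall fun ε => Eventually.of_forall (hb ε y)
      · refine Eventually.of_forall fun z => ?_
        have : Continuous fun ε : ℝ => φ (y + ε • z) * (3 * pk 1 z^5) :=
          (hφc.comp (by fun_prop)).mul continuous_const
        have := (this.tendsto 0).mono_left (nhdsWithin_le_nhds (s := Set.Ioi 0))
        simpa using this
  have limL' : Tendsto (fun ε : ℝ => ∫ y, m y * ∫ z, φ (y + ε • z) * (3 * pk 1 z^5)) (𝓝[>] 0)
      (𝓝 0) := by
    refine limR.congr' ?_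
    filter_upwards [self_mem_nhdsWithin] with ε hε
    exact (ident ε hε).symm
  have := tendsto_nhds_unique limL limL'
  simp only [← mul_assoc] at this
  rw [integral_mul_const] at this
  exact (mul_eq_zero.mp this).resolve_right pk_integral_pos.ne'

lemma harmonic_one : Harmonic (fun _ => (1:ℝ)) := by
  refine ⟨contDiff_const, fun x => ?_⟩
  unfold lap
  simp [iteratedFDeriv_const_of_ne]

lemma int_of_bdd {Ω : Set R3} (hΩc : IsCompact Ω) {F : R3 → ℝ} (hF : Measurable F) (C : ℝ)
    (hC : ∀ x, |F x| ≤ C) (hs : ∀ x ∉ Ω, F x = 0) : Integrable F := by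
  rw [← integrableOn_iff_integrable_of_support_subset (s := Ω)]
  · exact Measure.integrableOn_of_bounded (M := C) hΩc.measure_lt_top.ne hF.aestronglyMeasurable
      (Eventually.of_forall hC)
  · intro x hx
    by_contra h
    exact hx (hs x h)

end final

/-- under the integral identities (a), (b), (c) forced by equality of the
passive boundary measurements for the plate equation, plus the a.e. sign condition (d),
one gets `ρ₁g₁ = ρ₂g₂` a.e.; and if moreover `∫ ρ₁g₁ ≠ 0`, then all harmonic moments of
`ρ₁ − ρ₂` vanish. -/
theorem stmt_13 (R : ℝ) (hR : 0 < R)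
    (Ω : Set R3) (hΩc : IsCompact Ω) (hΩR : Ω ⊆ Metric.ball (0 : R3) R)
    (ρ₁ ρ₂ f₁ f₂ g₁ g₂ : R3 → ℝ)
    (hρ₁m : Measurable ρ₁) (hρ₂m : Measurable ρ₂)
    (hf₁m : Measurable f₁) (hf₂m : Measurable f₂)
    (hg₁m : Measurable g₁) (hg₂m : Measurable g₂)
    (hbd : ∃ C, ∀ x, |ρ₁ x| ≤ C ∧ |ρ₂ x| ≤ C ∧ |f₁ x| ≤ C ∧ |f₂ x| ≤ C ∧ |g₁ x| ≤ C ∧ |g₂ x| ≤ C)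
    (hsupp : ∀ x ∉ Ω, ρ₁ x = 1 ∧ ρ₂ x = 1 ∧ f₁ x = 0 ∧ f₂ x = 0 ∧ g₁ x = 0 ∧ g₂ x = 0)
    (ha : ∀ h : R3 → ℝ, Harmonic h → ∫ x : R3, (ρ₁ x * f₁ x - ρ₂ x * f₂ x) * h x = 0)
    (hb : ∀ h : R3 → ℝ, Harmonic h → ∫ x : R3, (ρ₁ x * g₁ x - ρ₂ x * g₂ x) * h x = 0)
    (hc : ∀ x : R3, ‖x‖ = R →
      (∫ z : R3, ρ₁ z * g₁ z) * (∫ y : R3, (ρ₁ y - 1) / (4 * Real.pi * ‖x - y‖)) +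
          (∫ y : R3, ρ₁ y * f₁ y) - (1 / 6) * ∫ y : R3, ρ₁ y * g₁ y * ‖x - y‖ ^ 2 =
        (∫ z : R3, ρ₂ z * g₂ z) * (∫ y : R3, (ρ₂ y - 1) / (4 * Real.pi * ‖x - y‖)) +
          (∫ y : R3, ρ₂ y * f₂ y) - (1 / 6) * ∫ y : R3, ρ₂ y * g₂ y * ‖x - y‖ ^ 2)
    (hd : (∀ᵐ x : R3 ∂volume, ρ₁ x * g₁ x ≤ ρ₂ x * g₂ x) ∨
      (∀ᵐ x : R3 ∂volume, ρ₂ x * g₂ x ≤ ρ₁ x * g₁ x)) :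
    (∀ᵐ x : R3 ∂volume, ρ₁ x * g₁ x = ρ₂ x * g₂ x) ∧
      ((∫ x : R3, ρ₁ x * g₁ x) ≠ 0 →
        ∀ h : R3 → ℝ, Harmonic h → ∫ x : R3, (ρ₁ x - ρ₂ x) * h x = 0) := by
  obtain ⟨C, hC⟩ := hbd
  have hC0 : 0 ≤ C := (abs_nonneg _).trans (hC 0).1
  have prod_int : ∀ a b : R3 → ℝ, Measurable a → Measurable b → (∀ x, |a x| ≤ C) →
      (∀ x, |b x| ≤ C) → (∀ x ∉ Ω, b x = 0) → Integrable (fun x => a x * b x) := by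
    intro a b ha hb hab hbb hb0
    refine int_of_bdd hΩc (ha.mul hb) (C * C) (fun x => ?_) (fun x hx => by simp [hb0 x hx])
    rw [abs_mul]
    exact mul_le_mul (hab x) (hbb x) (abs_nonneg _) hC0
  have ig1 := prod_int ρ₁ g₁ hρ₁m hg₁m (fun x => (hC x).1) (fun x => (hC x).2.2.2.2.1)
    (fun x hx => (hsupp x hx).2.2.2.2.1)
  have ig2 := prod_int ρ₂ g₂ hρ₂m hg₂m (fun x => (hC x).2.1) (fun x => (hC x).2.2.2.2.2)
    (fun x hx => (hsupp x hx).2.2.2.2.2)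
  have if1 := prod_int ρ₁ f₁ hρ₁m hf₁m (fun x => (hC x).1) (fun x => (hC x).2.2.1)
    (fun x hx => (hsupp x hx).2.2.1)
  have if2 := prod_int ρ₂ f₂ hρ₂m hf₂m (fun x => (hC x).2.1) (fun x => (hC x).2.2.2.1)
    (fun x hx => (hsupp x hx).2.2.2.1)
  have hb1 := hb _ harmonic_one
  have ha1 := ha _ harmonic_one
  simp only [mul_one] at hb1 ha1
  have hg : ∀ᵐ x : R3 ∂volume, ρ₁ x * g₁ x = ρ₂ x * g₂ x := by
    rcases hd with hd | hd
    · have hb2 : ∫ x : R3, (ρ₂ x * g₂ x - ρ₁ x * g₁ x) = 0 := by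
        rw [integral_sub ig1 ig2] at hb1
        rw [integral_sub ig2 ig1]; linarith
      have := (integral_eq_zero_iff_of_nonneg_ae (hd.mono fun x hx => sub_nonneg.mpr hx)
        (ig2.sub ig1)).mp hb2
      filter_upwards [this] with x hx
      simp only [Pi.zero_apply] at hx
      linarith
    · have := (integral_eq_zero_iff_of_nonneg_ae (hd.mono fun x hx => sub_nonneg.mpr hx)
        (ig1.sub ig2)).mp hb1
      filter_upwards [this] with x hx
      simp only [Pi.zero_apply] at hx
      linarith
  refine ⟨hg, fun hne h hh => ?_⟩
  rw [integral_sub if1 if2] at ha1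
  -- a radius strictly below `R` whose ball contains `Ω`
  obtain ⟨r, hr0, hrR, hΩr⟩ : ∃ r, 0 ≤ r ∧ r < R ∧ ∀ y ∈ Ω, ‖y‖ ≤ r := by
    rcases Ω.eq_empty_or_nonempty with he | hne
    · exact ⟨0, le_rfl, hR, by simp [he]⟩
    · obtain ⟨a, haΩ, hamax⟩ := hΩc.exists_isMaxOn hne continuous_norm.continuousOn
      exact ⟨‖a‖, norm_nonneg _, by simpa using hΩR haΩ, fun y hy => hamax hy⟩
  have hout : ∀ y : R3, r < ‖y‖ → y ∉ Ω := fun y hy hyΩ => absurd (hΩr y hyΩ) (not_le.mpr hy)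
  have ir1 : Integrable (fun x => ρ₁ x - 1) := by
    refine int_of_bdd hΩc (hρ₁m.sub_const 1) (C + 1) (fun x => ?_)
      (fun x hx => by simp [(hsupp x hx).1])
    obtain ⟨h1, h2⟩ := abs_le.mp (hC x).1
    rw [abs_le]; constructor <;> linarith
  have ir2 : Integrable (fun x => ρ₂ x - 1) := by
    refine int_of_bdd hΩc (hρ₂m.sub_const 1) (C + 1) (fun x => ?_)
      (fun x hx => by simp [(hsupp x hx).2.1])
    obtain ⟨h1, h2⟩ := abs_le.mp (hC x).2.1
    rw [abs_le]; constructor <;> linarith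
  have im : Integrable (fun x => ρ₁ x - ρ₂ x) := by
    refine (ir1.sub ir2).congr (Filter.Eventually.of_forall fun x => ?_)
    simp
  refine moments hr0 hrR im (fun y hy => ?_) (fun x hx => ?_) h hh
  · have := hsupp y (hout y hy)
    rw [this.1, this.2.1, sub_self]
  · have e1 : ∫ z : R3, ρ₂ z * g₂ z = ∫ z : R3, ρ₁ z * g₁ z :=
      integral_congr_ae (hg.mono fun x hx => hx.symm)
    have e2 : ∫ y : R3, ρ₂ y * g₂ y * ‖x - y‖ ^ 2 = ∫ y : R3, ρ₁ y * g₁ y * ‖x - y‖ ^ 2 :=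
      integral_congr_ae (hg.mono fun z hz => by simp only [hz])
    have hcx := hc x hx
    rw [e1, e2] at hcx
    have e3 : (∫ y : R3, (ρ₁ y - 1) / (4 * Real.pi * ‖x - y‖)) =
        ∫ y : R3, (ρ₂ y - 1) / (4 * Real.pi * ‖x - y‖) := by
      apply mul_left_cancel₀ hne
      linarith
    have conv : ∀ F : R3 → ℝ, ∫ y : R3, F y / (4 * Real.pi * ‖x - y‖) =
        (4 * Real.pi)⁻¹ * ∫ y : R3, F y * ‖x - y‖⁻¹ := by
      intro F
      rw [← integral_const_mul]
      congr 1; funext y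
      rw [div_eq_mul_inv, mul_inv]; ring
    rw [conv (fun y => ρ₁ y - 1), conv (fun y => ρ₂ y - 1)] at e3
    have e4 := mul_left_cancel₀ (by positivity) e3
    have p1 := pot_int hrR ir1 (fun y hy => by rw [(hsupp y (hout y hy)).1, sub_self]) x hx.ge
    have p2 := pot_int hrR ir2 (fun y hy => by rw [(hsupp y (hout y hy)).2.1, sub_self]) x hx.ge
    have : (fun y => (ρ₁ y - ρ₂ y) * ‖x - y‖⁻¹) =
        fun y => (ρ₁ y - 1) * ‖x - y‖⁻¹ - (ρ₂ y - 1) * ‖x - y‖⁻¹ := by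
      funext y; ring
    rw [this, integral_sub p1 p2, e4, sub_self]
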